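/- Let (X, Y) and (X', Y') be pairs of random variables with full-support pmfs P_{XY} and P_{X'Y'} on the common finite alphabet 𝒳 × 𝒳, with Δ = I(X' ∧ Y') − I(X ∧ Y) > 0, and let (X, Y) and (X', Y') denote n i.i.d. samples from P_{XY} and P_{X'Y'}, respectively, where n > max{ (|𝒳|²−1)/(2^{Δ/2}−1), (|𝒳|−1)/(2^{Δ/4}−1) }. Then P( I_EMI^{(n)}(X ∧ Y) ≥ I_EMI^{(n)}(X' ∧ Y') ) ≤ 2 max{ exp( −2n (Δ/2 − bias(I_EMI^{(n)}(X ∧ Y)))² / (36 log² n) ), exp( −2n (Δ/2 − bias(I_EMI^{(n)}(X' ∧ Y')))² / (36 log² n) ) }. -/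

import Mathlib

open Classical
open scoped BigOperators

noncomputable section

namespace EMI

/-- Empirical distribution (type) of a length-`n` sample sequence. -/
def empDist {n : ℕ} {α : Type*} [Fintype α] (s : Fin n → α) (a : α) : ℝ :=
  ((Finset.univ.filter fun t => s t = a).card : ℝ) / n

/-- Shannon entropy (base 2) of a pmf on a finite type. -/
def ent {α : Type*} [Fintype α] (q : α → ℝ) : ℝ :=
  -∑ a, q a * Real.logb 2 (q a)

/-- Empirical mutual information `I_EMI^{(n)}` computed from `n` paired samples:
entropy of the two marginal types minus entropy of the joint type. -/
def emi {n : ℕ} {𝒳 𝒴 : Type*} [Fintype 𝒳] [Fintype 𝒴] (s : Fin n → 𝒳 × 𝒴) : ℝ :=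
  ent (empDist fun t => (s t).1) + ent (empDist fun t => (s t).2) - ent (empDist s)

/-- Mutual information I(X ∧ Y) of a joint pmf on a product of finite types. -/
def miDist {𝒳 𝒴 : Type*} [Fintype 𝒳] [Fintype 𝒴] (p : 𝒳 × 𝒴 → ℝ) : ℝ :=
  ent (fun a => ∑ b, p (a, b)) + ent (fun b => ∑ a, p (a, b)) - ent p

/-- The i.i.d. product pmf of `n` samples from `p`. -/
def prodP {n : ℕ} {α : Type*} [Fintype α] (p : α → ℝ) (ω : Fin n → α) : ℝ :=
  ∏ t, p (ω t)

/-- Expectation with respect to a pmf `P` on a finite sample space. -/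
def expect {Ω : Type*} [Fintype Ω] (P : Ω → ℝ) (f : Ω → ℝ) : ℝ := ∑ ω, P ω * f ω

/-- Probability of an event with respect to a pmf `P` on a finite sample space. -/
def probEvent {Ω : Type*} [Fintype Ω] (P : Ω → ℝ) (s : Ω → Prop) : ℝ :=
  ∑ ω, if s ω then P ω else 0

lemma prodP_nonneg {n : ℕ} {α : Type*} [Fintype α] {p : α → ℝ} (hp : ∀ a, 0 ≤ p a)
    (ω : Fin n → α) : 0 ≤ prodP p ω :=
  Finset.prod_nonneg fun _ _ => hp _

lemma expect_mono {Ω : Type*} [Fintype Ω] {P f g : Ω → ℝ} (hP : ∀ ω, 0 ≤ P ω)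
    (h : ∀ ω, f ω ≤ g ω) : expect P f ≤ expect P g :=
  Finset.sum_le_sum fun ω _ => mul_le_mul_of_nonneg_left (h ω) (hP ω)

lemma expect_const {Ω : Type*} [Fintype Ω] {P : Ω → ℝ} (hP : ∑ ω, P ω = 1) (c : ℝ) :
    expect P (fun _ => c) = c := by
  rw [expect, ← Finset.sum_mul, hP, one_mul]

lemma expect_add {Ω : Type*} [Fintype Ω] (P f g : Ω → ℝ) :
    expect P (fun ω => f ω + g ω) = expect P f + expect P g := by
  simp only [expect, mul_add, Finset.sum_add_distrib]

lemma expect_sub {Ω : Type*} [Fintype Ω] (P f g : Ω → ℝ) :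
    expect P (fun ω => f ω - g ω) = expect P f - expect P g := by
  simp only [expect, mul_sub, Finset.sum_sub_distrib]

lemma expect_const_mul {Ω : Type*} [Fintype Ω] (P : Ω → ℝ) (c : ℝ) (f : Ω → ℝ) :
    expect P (fun ω => c * f ω) = c * expect P f := by
  simp only [expect, Finset.mul_sum]
  exact Finset.sum_congr rfl fun _ _ => by ring

lemma expect_mul_const {Ω : Type*} [Fintype Ω] (P : Ω → ℝ) (c : ℝ) (f : Ω → ℝ) :
    expect P (fun ω => f ω * c) = expect P f * c := by
  simp only [expect, Finset.sum_mul, mul_assoc]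

lemma expect_sum {Ω ι : Type*} [Fintype Ω] [Fintype ι] (P : Ω → ℝ) (f : ι → Ω → ℝ) :
    expect P (fun ω => ∑ i, f i ω) = ∑ i, expect P (f i) := by
  simp only [expect, Finset.mul_sum]
  exact Finset.sum_comm

lemma expect_prodP_zero {α : Type*} [Fintype α] (p : α → ℝ) (f : (Fin 0 → α) → ℝ) :
    expect (prodP p) f = f Fin.elim0 := by
  rw [expect, Fintype.sum_unique, Subsingleton.elim (default : Fin 0 → α) Fin.elim0]
  simp [prodP]

/-- The expectation over `n + 1` samples, conditioning on all samples but the first. -/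
lemma expect_prodP_succ {n : ℕ} {α : Type*} [Fintype α] (p : α → ℝ)
    (f : (Fin (n + 1) → α) → ℝ) :
    expect (prodP p) f =
      expect (prodP p) fun ω : Fin n → α => expect p fun a => f (Fin.cons a ω) := by
  simp only [expect, Finset.mul_sum]
  rw [Finset.sum_comm, ← Fintype.sum_prod_type', ← (Fin.consEquiv fun _ => α).sum_comp]
  refine Finset.sum_congr rfl fun x _ => ?_
  rw [show (Fin.consEquiv fun _ => α) x = Fin.cons x.1 x.2 from rfl]
  simp only [prodP, Fin.prod_univ_succ, Fin.cons_zero, Fin.cons_succ]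
  ring

lemma sum_prodP {n : ℕ} {α : Type*} [Fintype α] {p : α → ℝ} (hp : ∑ a, p a = 1) :
    ∑ ω : Fin n → α, prodP p ω = 1 := by
  suffices h : expect (prodP p) (fun _ : Fin n → α => 1) = 1 by simpa [expect] using h
  induction n with
  | zero => rw [expect_prodP_zero]
  | succ n ih => rw [expect_prodP_succ, expect_const hp, ih]

/-- **Hoeffding's lemma** for a pmf on a finite type. -/
lemma expect_exp_le {α : Type*} [Fintype α] {p : α → ℝ} (hp : ∀ a, 0 ≤ p a)
    (hp1 : ∑ a, p a = 1) (f : α → ℝ) {c : ℝ} (hf : ∀ a b, f a - f b ≤ c) :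
    expect p (fun a => Real.exp (f a)) ≤ Real.exp (expect p f + c ^ 2 / 8) := by
  let _ : MeasurableSpace α := ⊤
  have hne : Nonempty α := by
    by_contra h
    rw [not_nonempty_iff] at h
    simp at hp1
  let P : PMF α := PMF.ofFintype (fun a => ENNReal.ofReal (p a)) (by
    rw [← ENNReal.ofReal_sum_of_nonneg fun a _ => hp a, hp1, ENNReal.ofReal_one])
  have hP : ∀ g : α → ℝ, ∫ a, g a ∂P.toMeasure = expect p g := fun g => by
    rw [PMF.integral_eq_sum]
    exact Finset.sum_congr rfl fun a _ => by simp [P, ENNReal.toReal_ofReal (hp a)]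
  obtain ⟨m, hm⟩ := Finite.exists_min f
  have h := (ProbabilityTheory.hasSubgaussianMGF_of_mem_Icc (μ := P.toMeasure) (X := f)
    (a := f m) (b := f m + c) (measurable_of_finite f).aemeasurable
    (Filter.Eventually.of_forall fun a => ⟨hm a, by linarith [hf a m]⟩)).mgf_le 1
  simp only [ProbabilityTheory.mgf, hP, one_mul] at h
  have hv : (((‖f m + c - f m‖₊ / 2) ^ 2 : NNReal) : ℝ) * 1 ^ 2 / 2 = c ^ 2 / 8 := by
    push_cast
    rw [add_sub_cancel_left, Real.norm_eq_abs, div_pow, sq_abs]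
    ring
  rw [hv] at h
  calc expect p (fun a => Real.exp (f a))
      = Real.exp (expect p f) * expect p (fun a => Real.exp (f a - expect p f)) := by
        rw [← expect_const_mul]
        congr 1
        funext a
        rw [← Real.exp_add, add_sub_cancel]
    _ ≤ Real.exp (expect p f) * Real.exp (c ^ 2 / 8) := by gcongr
    _ = _ := (Real.exp_add _ _).symm

/-- The exponential moment bound behind **McDiarmid's inequality**. -/
lemma expect_exp_le_of_bounded_differences {n : ℕ} {α : Type*} [Fintype α] {p : α → ℝ}
    (hp : ∀ a, 0 ≤ p a) (hp1 : ∑ a, p a = 1) (f : (Fin n → α) → ℝ) {c : ℝ}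
    (hf : ∀ ω i a, f (Function.update ω i a) - f ω ≤ c) :
    expect (prodP p) (fun ω => Real.exp (f ω)) ≤
      Real.exp (expect (prodP p) f + n * c ^ 2 / 8) := by
  induction n with
  | zero => simp [expect_prodP_zero]
  | succ n ih =>
    set g : (Fin n → α) → ℝ := fun ω => expect p fun a => f (Fin.cons a ω) with hg
    have hgd : ∀ ω i a, g (Function.update ω i a) - g ω ≤ c := fun ω i a => by
      rw [hg]
      dsimp only
      rw [← expect_sub]
      refine (expect_mono hp fun b => ?_).trans_eq (expect_const hp1 c)
      rw [Fin.cons_update]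
      exact hf _ _ _
    rw [expect_prodP_succ, expect_prodP_succ]
    calc expect (prodP p) (fun ω : Fin n → α => expect p fun a => Real.exp (f (Fin.cons a ω)))
        ≤ expect (prodP p) fun ω => Real.exp (g ω) * Real.exp (c ^ 2 / 8) :=
          expect_mono (prodP_nonneg hp) fun ω => by
            rw [← Real.exp_add]
            refine expect_exp_le hp hp1 _ fun a b => ?_
            have := hf (Fin.cons b ω) 0 a
            rwa [Fin.update_cons_zero] at this
      _ = expect (prodP p) (fun ω => Real.exp (g ω)) * Real.exp (c ^ 2 / 8) :=
          expect_mul_const _ _ _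
      _ ≤ Real.exp (expect (prodP p) g + n * c ^ 2 / 8) * Real.exp (c ^ 2 / 8) := by
          gcongr
          exact ih g hgd
      _ = Real.exp (expect (prodP p) g + (n + 1 : ℕ) * c ^ 2 / 8) := by
          rw [← Real.exp_add]
          push_cast
          ring_nf

/-- Two independent functions with bounded differences are ordered against their means with
exponentially small probability. -/
lemma probEvent_ge_le {n : ℕ} {α : Type*} [Fintype α] {p q : α → ℝ}
    (hp : ∀ a, 0 ≤ p a) (hp1 : ∑ a, p a = 1) (hq : ∀ a, 0 ≤ q a) (hq1 : ∑ a, q a = 1)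
    (f : (Fin n → α) → ℝ) {c : ℝ} (hf : ∀ ω i a, |f (Function.update ω i a) - f ω| ≤ c)
    (hn : 0 < n) (hc : 0 < c) (hT : expect (prodP p) f ≤ expect (prodP q) f) :
    probEvent (fun ω : (Fin n → α) × (Fin n → α) => prodP p ω.1 * prodP q ω.2)
        (fun ω => f ω.1 ≥ f ω.2)
      ≤ Real.exp (-(expect (prodP q) f - expect (prodP p) f) ^ 2 / (n * c ^ 2)) := by
  set T := expect (prodP q) f - expect (prodP p) f with hTdef
  have hn' : (0 : ℝ) < n := by exact_mod_cast hn
  set l : ℝ := 2 * T / (n * c ^ 2) with hl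
  have hl0 : 0 ≤ l := by
    have : 0 ≤ T := sub_nonneg.2 hT
    positivity
  have h1 := expect_exp_le_of_bounded_differences hp hp1 (fun ω => l * f ω) (c := l * c)
    fun ω i a => by
      rw [← mul_sub]
      exact mul_le_mul_of_nonneg_left ((le_abs_self _).trans (hf ω i a)) hl0
  have h2 := expect_exp_le_of_bounded_differences hq hq1 (fun ω => -l * f ω) (c := l * c)
    fun ω i a => by
      have := mul_le_mul_of_nonneg_left ((neg_abs_le _).trans' (neg_le_neg (hf ω i a))) hl0
      linarith
  rw [expect_const_mul] at h1 h2
  calc probEvent (fun ω : (Fin n → α) × (Fin n → α) => prodP p ω.1 * prodP q ω.2)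
        (fun ω => f ω.1 ≥ f ω.2)
      ≤ ∑ ω : (Fin n → α) × (Fin n → α),
          prodP p ω.1 * Real.exp (l * f ω.1) * (prodP q ω.2 * Real.exp (-l * f ω.2)) := by
        refine Finset.sum_le_sum fun ω _ => ?_
        have h0 : 0 ≤ prodP p ω.1 * prodP q ω.2 :=
          mul_nonneg (prodP_nonneg hp _) (prodP_nonneg hq _)
        rw [mul_mul_mul_comm, ← Real.exp_add]
        split_ifs with h
        · refine le_mul_of_one_le_right h0 (Real.one_le_exp ?_)
          have := mul_le_mul_of_nonneg_left h hl0
          linarith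
        · positivity
    _ = expect (prodP p) (fun ω => Real.exp (l * f ω)) *
          expect (prodP q) (fun ω => Real.exp (-l * f ω)) := by
        rw [expect, expect, Finset.sum_mul_sum, ← Fintype.sum_prod_type']
    _ ≤ _ := mul_le_mul h1 h2
        (Finset.sum_nonneg fun ω _ => mul_nonneg (prodP_nonneg hq _) (Real.exp_pos _).le)
        (Real.exp_pos _).le
    _ = _ := by
        rw [← Real.exp_add]
        congr 1
        have : l * expect (prodP p) f + n * (l * c) ^ 2 / 8 +
            (-l * expect (prodP q) f + n * (l * c) ^ 2 / 8) = -l * T + n * (l * c) ^ 2 / 4 := by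
          rw [hTdef]
          ring
        rw [this, hl]
        field_simp
        ring

/-- The number of occurrences of `a` in the sequence `s`. -/
def count {n : ℕ} {α : Type*} (s : Fin n → α) (a : α) : ℕ :=
  (Finset.univ.filter fun t => s t = a).card

/-- The number of occurrences of `a` in the sequence `s` at positions other than `i`. -/
def countExcept {n : ℕ} {α : Type*} (s : Fin n → α) (i : Fin n) (a : α) : ℕ :=
  (Finset.univ.filter fun t => t ≠ i ∧ s t = a).card

/-- The function `k ↦ k log₂ k` on the natural numbers. -/
def mulLogb (k : ℕ) : ℝ := k * Real.logb 2 k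

/-- The increment `(k + 1) log₂ (k + 1) - k log₂ k`. -/
def mulLogbIncr (k : ℕ) : ℝ := mulLogb (k + 1) - mulLogb k

lemma sum_count {n : ℕ} {α : Type*} [Fintype α] (s : Fin n → α) :
    ∑ a, (count s a : ℝ) = n := by
  have h := Finset.card_eq_sum_card_fiberwise (s := (Finset.univ : Finset (Fin n)))
    (t := (Finset.univ : Finset α)) (f := s) (fun _ _ => Finset.mem_coe.2 (Finset.mem_univ _))
  rw [Finset.card_univ, Fintype.card_fin] at h
  rw [← Nat.cast_sum]
  exact_mod_cast h.symm

lemma mul_ent_empDist {n : ℕ} {α : Type*} [Fintype α] (s : Fin n → α) :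
    n * ent (empDist s) = n * Real.logb 2 n - ∑ a, mulLogb (count s a) := by
  rcases Nat.eq_zero_or_pos n with rfl | hn
  · simp [count, mulLogb]
  have hn' : (n : ℝ) ≠ 0 := by positivity
  have key : ∀ a, n * (empDist s a * Real.logb 2 (empDist s a)) =
      mulLogb (count s a) - count s a * Real.logb 2 n := fun a => by
    rw [show empDist s a = (count s a : ℝ) / n from rfl, mulLogb]
    rcases eq_or_ne (count s a : ℝ) 0 with h | h
    · simp [h]
    · rw [Real.logb_div h hn']
      field_simp
  rw [ent, mul_neg, Finset.mul_sum, Finset.sum_congr rfl fun a _ => key a,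
    Finset.sum_sub_distrib, ← Finset.sum_mul, sum_count]
  ring

lemma count_eq {n : ℕ} {α : Type*} (s : Fin n → α) (i : Fin n) (a : α) :
    count s a = countExcept s i a + if s i = a then 1 else 0 := by
  rw [count, countExcept]
  split_ifs with h
  · rw [← Finset.card_erase_add_one (a := i) (by simpa using h)]
    refine congrArg (fun S : Finset (Fin n) => S.card + 1) ?_
    ext t
    simp
  · rw [add_zero]
    congr 1
    ext t
    simp only [Finset.mem_filter, Finset.mem_univ, true_and]
    exact ⟨fun ht => ⟨fun hti => h (hti ▸ ht), ht⟩, And.right⟩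

lemma sum_mulLogb_count {n : ℕ} {α : Type*} [Fintype α] (s : Fin n → α) (i : Fin n) :
    ∑ a, mulLogb (count s a) =
      ∑ a, mulLogb (countExcept s i a) + mulLogbIncr (countExcept s i (s i)) := by
  have h : ∀ a, mulLogb (count s a) =
      mulLogb (countExcept s i a) + if s i = a then mulLogbIncr (countExcept s i a) else 0 :=
    fun a => by
      rw [count_eq s i a]
      split_ifs <;> simp [mulLogbIncr]
  rw [Finset.sum_congr rfl fun a _ => h a, Finset.sum_add_distrib, Finset.sum_ite_eq]
  simp

lemma countExcept_update {n : ℕ} {α : Type*} (s : Fin n → α) (i : Fin n) (z : α) :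
    countExcept (Function.update s i z) i = countExcept s i := by
  funext a
  rw [countExcept, countExcept]
  congr 1
  ext t
  simp only [Finset.mem_filter, Finset.mem_univ, true_and]
  exact and_congr_right fun h => by rw [Function.update_of_ne h]

lemma countExcept_comp_le {n : ℕ} {α β : Type*} (s : Fin n → α) (i : Fin n) (φ : α → β) (a : α) :
    countExcept s i a ≤ countExcept (fun t => φ (s t)) i (φ a) :=
  Finset.card_le_card fun t => by
    simp only [Finset.mem_filter, Finset.mem_univ, true_and]
    exact fun h => ⟨h.1, congrArg φ h.2⟩

lemma countExcept_le {n : ℕ} {α : Type*} (s : Fin n → α) (i : Fin n) (a : α) :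
    countExcept s i a ≤ n - 1 := by
  calc countExcept s i a ≤ (Finset.univ.erase i).card := Finset.card_le_card fun t => by simp +contextual
    _ = n - 1 := by simp

lemma mulLogbIncr_monotone : Monotone mulLogbIncr := by
  refine monotone_nat_of_le_succ fun k => ?_
  have h := Real.convexOn_mul_log.slope_mono_adjacent (x := (k : ℝ)) (y := k + 1) (z := k + 2)
    (Set.mem_Ici.2 (by positivity)) (Set.mem_Ici.2 (by positivity)) (by linarith) (by linarith)
  norm_num at h
  have hc : ∀ m : ℕ, mulLogb m = m * Real.log m / Real.log 2 := fun m => by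
    rw [mulLogb, Real.logb, mul_div_assoc]
  rw [mulLogbIncr, mulLogbIncr, hc, hc, hc, ← sub_div, ← sub_div]
  refine div_le_div_of_nonneg_right ?_ (Real.log_pos one_lt_two).le
  push_cast
  rw [show (k : ℝ) + 1 + 1 = k + 2 by ring]
  linarith

lemma mulLogbIncr_nonneg (k : ℕ) : 0 ≤ mulLogbIncr k := by
  refine le_trans ?_ (mulLogbIncr_monotone (Nat.zero_le k))
  simp [mulLogbIncr, mulLogb]

lemma mulLogbIncr_pred_le {n : ℕ} (hn : 2 ≤ n) : mulLogbIncr (n - 1) ≤ 2 * Real.logb 2 n := by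
  obtain ⟨m, rfl⟩ : ∃ m, n = m + 1 := ⟨n - 1, by omega⟩
  have hm : 1 ≤ m := by omega
  have hm0 : (0 : ℝ) < m := by exact_mod_cast hm
  suffices h : (m - 1) * Real.log (m + 1) ≤ m * Real.log m by
    have h2 : 0 < Real.log 2 := Real.log_pos one_lt_two
    rw [add_tsub_cancel_right, mulLogbIncr, mulLogb, mulLogb, Real.logb, Real.logb, ← mul_div_assoc,
      ← mul_div_assoc, ← mul_div_assoc, ← sub_div]
    gcongr
    push_cast
    linarith
  rcases hm.eq_or_lt with rfl | hm2
  · simp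
  have h3 : (1 : ℝ) ≤ Real.log (m + 1) := by
    rw [Real.le_log_iff_exp_le (by positivity)]
    have : (2 : ℝ) ≤ m := by exact_mod_cast hm2
    linarith [Real.exp_one_lt_d9]
  have h4 : Real.log (m + 1) - Real.log m ≤ 1 / m := by
    rw [← Real.log_div (by positivity) hm0.ne']
    refine (Real.log_le_sub_one_of_pos (by positivity)).trans_eq ?_
    field_simp
    ring
  have h5 : m * (Real.log (m + 1) - Real.log m) ≤ 1 := by
    calc m * (Real.log (m + 1) - Real.log m) ≤ m * (1 / m) := by gcongr
      _ = 1 := by field_simp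
  linarith

lemma abs_emi_update_sub_le {n : ℕ} {𝒳 𝒴 : Type*} [Fintype 𝒳] [Fintype 𝒴] (hn : 2 ≤ n)
    (s : Fin n → 𝒳 × 𝒴) (i : Fin n) (z : 𝒳 × 𝒴) :
    |emi (Function.update s i z) - emi s| ≤ 4 * Real.logb 2 n / n := by
  have hn0 : (0 : ℝ) < n := by
    have : 0 < n := by omega
    exact_mod_cast this
  have hfst : (fun t => (Function.update s i z t).1) = Function.update (fun t => (s t).1) i z.1 :=
    Function.comp_update Prod.fst s i z
  have hsnd : (fun t => (Function.update s i z t).2) = Function.update (fun t => (s t).2) i z.2 :=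
    Function.comp_update Prod.snd s i z
  set d : 𝒳 × 𝒴 → ℝ := fun a => mulLogbIncr (countExcept (fun t => (s t).1) i a.1) +
    mulLogbIncr (countExcept (fun t => (s t).2) i a.2) - mulLogbIncr (countExcept s i a) with hd
  have hdiff : n * (emi (Function.update s i z) - emi s) = d (s i) - d z := by
    rw [emi, emi, hfst, hsnd, mul_sub, mul_sub, mul_sub, mul_add, mul_add]
    simp only [mul_ent_empDist, sum_mulLogb_count _ i, countExcept_update, Function.update_self, hd]
    ring
  have hd0 : ∀ a, 0 ≤ d a ∧ d a ≤ 4 * Real.logb 2 n := fun a => by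
    have h1 := mulLogbIncr_monotone (countExcept_comp_le s i Prod.fst a)
    have h2 := mulLogbIncr_nonneg (countExcept (fun t => (s t).2) i a.2)
    have h3 := mulLogbIncr_monotone (countExcept_le (fun t => (s t).1) i a.1)
    have h4 := mulLogbIncr_monotone (countExcept_le (fun t => (s t).2) i a.2)
    have h5 := mulLogbIncr_nonneg (countExcept s i a)
    have h6 := mulLogbIncr_pred_le hn
    exact ⟨by simp only [hd]; linarith, by simp only [hd]; linarith⟩
  rw [le_div_iff₀ hn0, ← abs_of_pos hn0, ← abs_mul, mul_comm, abs_of_pos hn0, hdiff]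
  have := hd0 z
  have := hd0 (s i)
  rw [abs_le]
  constructor <;> linarith

lemma expect_prodP_sum {n : ℕ} {α : Type*} [Fintype α] {p : α → ℝ} (hp1 : ∑ a, p a = 1)
    (h : α → ℝ) :
    expect (prodP p) (fun s : Fin n → α => ∑ t, h (s t)) = n * expect p h := by
  induction n with
  | zero => simp [expect_prodP_zero]
  | succ n ih =>
    rw [expect_prodP_succ]
    simp only [Fin.sum_univ_succ, Fin.cons_zero, Fin.cons_succ, expect_add, expect_const hp1,
      expect_const (sum_prodP hp1), ih]
    push_cast
    ring

lemma expect_prodP_sum_sq {n : ℕ} {α : Type*} [Fintype α] {p : α → ℝ} (hp1 : ∑ a, p a = 1)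
    (h : α → ℝ) :
    expect (prodP p) (fun s : Fin n → α => (∑ t, h (s t)) ^ 2) =
      n * expect p (fun a => h a ^ 2) + n * (n - 1) * expect p h ^ 2 := by
  induction n with
  | zero => simp [expect_prodP_zero]
  | succ n ih =>
    rw [expect_prodP_succ]
    simp only [Fin.sum_univ_succ, Fin.cons_zero, Fin.cons_succ, add_sq, expect_add,
      expect_const hp1, expect_const (sum_prodP hp1), expect_mul_const, expect_const_mul, ih,
      expect_prodP_sum hp1]
    push_cast
    ring

lemma empDist_eq_sum {n : ℕ} {β : Type*} [Fintype β] (s : Fin n → β) (b : β) :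
    empDist s b = (∑ t, if s t = b then (1 : ℝ) else 0) / n := by
  rw [empDist, Finset.sum_boole]

lemma empDist_nonneg {n : ℕ} {β : Type*} [Fintype β] (s : Fin n → β) (b : β) :
    0 ≤ empDist s b := by
  rw [empDist]
  positivity

lemma sum_empDist {n : ℕ} {β : Type*} [Fintype β] (hn : 0 < n) (s : Fin n → β) :
    ∑ b, empDist s b = 1 := by
  have h : ∀ b, empDist s b = count s b / n := fun _ => rfl
  rw [Finset.sum_congr rfl fun b _ => h b, ← Finset.sum_div, sum_count, div_self]
  positivity

/-- The relative entropy, base 2, of `q` with respect to `r`. -/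
def relEnt {β : Type*} [Fintype β] (q r : β → ℝ) : ℝ :=
  ∑ b, q b * (Real.logb 2 (q b) - Real.logb 2 (r b))

/-- Gibbs' inequality. -/
lemma relEnt_nonneg {β : Type*} [Fintype β] {q r : β → ℝ} (hq : ∀ b, 0 ≤ q b)
    (hq1 : ∑ b, q b = 1) (hr : ∀ b, 0 < r b) (hr1 : ∑ b, r b = 1) : 0 ≤ relEnt q r := by
  have h : ∀ b, (q b - r b) / Real.log 2 ≤
      q b * (Real.logb 2 (q b) - Real.logb 2 (r b)) := fun b => by
    rw [Real.logb, Real.logb, ← sub_div, ← mul_div_assoc]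
    refine div_le_div_of_nonneg_right ?_ (Real.log_pos one_lt_two).le
    rcases (hq b).eq_or_lt with h0 | h0
    · simp [← h0, (hr b).le]
    · have h1 := Real.log_le_sub_one_of_pos (div_pos (hr b) h0)
      rw [Real.log_div (hr b).ne' h0.ne'] at h1
      have h2 := mul_le_mul_of_nonneg_left h1 h0.le
      rw [mul_sub (q b) (r b / q b), mul_div_cancel₀ _ h0.ne'] at h2
      linarith
  calc (0 : ℝ) = ∑ b, (q b - r b) / Real.log 2 := by
        rw [← Finset.sum_div, Finset.sum_sub_distrib, hq1, hr1, sub_self, zero_div]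
    _ ≤ relEnt q r := Finset.sum_le_sum fun b _ => h b

/-- The tangent-line form of the bound of relative entropy by the `χ²` divergence. -/
lemma relEnt_le {β : Type*} [Fintype β] {q r : β → ℝ} (hq : ∀ b, 0 ≤ q b)
    (hq1 : ∑ b, q b = 1) (hr : ∀ b, 0 < r b) {w : ℝ} (hw : 0 < w) :
    relEnt q r ≤ Real.logb 2 w + ((∑ b, q b ^ 2 / r b) / w - 1) / Real.log 2 := by
  have h : ∀ b, q b * (Real.logb 2 (q b) - Real.logb 2 (r b)) ≤
      q b * (Real.logb 2 w - 1 / Real.log 2) + q b ^ 2 / r b / w / Real.log 2 := fun b => by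
    rw [Real.logb, Real.logb, Real.logb, ← sub_div, ← sub_div, ← mul_div_assoc, ← mul_div_assoc,
      ← add_div]
    refine div_le_div_of_nonneg_right ?_ (Real.log_pos one_lt_two).le
    rcases (hq b).eq_or_lt with h0 | h0
    · simp [← h0]
    · have hrw := mul_pos (hr b) hw
      have h1 := Real.log_le_sub_one_of_pos (div_pos h0 hrw)
      rw [Real.log_div h0.ne' hrw.ne', Real.log_mul (hr b).ne' hw.ne'] at h1
      have h2 := mul_le_mul_of_nonneg_left h1 h0.le
      have h3 : q b * (q b / (r b * w)) = q b ^ 2 / r b / w := by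
        rw [div_div]
        ring
      rw [mul_sub (q b) (q b / _), h3] at h2
      linarith
  refine (Finset.sum_le_sum fun b _ => h b).trans_eq ?_
  rw [Finset.sum_add_distrib, ← Finset.sum_mul, hq1, ← Finset.sum_div, ← Finset.sum_div]
  ring

section Bias

variable {n : ℕ} {α β : Type*} [Fintype α] [Fintype β] {p : α → ℝ} {q : β → ℝ} {φ : α → β}

lemma expect_comp (hq : ∀ b, q b = ∑ a, if φ a = b then p a else 0) (g : β → ℝ) :
    expect p (fun a => g (φ a)) = expect q g := by
  simp only [expect, hq, Finset.sum_mul]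
  rw [Finset.sum_comm]
  refine Finset.sum_congr rfl fun a _ => ?_
  simp [ite_mul]

lemma sum_pushforward (hq : ∀ b, q b = ∑ a, if φ a = b then p a else 0)
    (hp1 : ∑ a, p a = 1) : ∑ b, q b = 1 := by
  have := expect_comp hq fun _ => 1
  rw [expect_const hp1] at this
  simpa [expect] using this.symm

lemma expect_boole (b : β) : expect q (fun b' => if b' = b then (1 : ℝ) else 0) = q b := by
  simp [expect]

lemma expect_empDist (hn : 0 < n) (hp1 : ∑ a, p a = 1)
    (hq : ∀ b, q b = ∑ a, if φ a = b then p a else 0) (b : β) :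
    expect (prodP p) (fun s : Fin n → α => empDist (fun t => φ (s t)) b) = q b := by
  have hn' : (n : ℝ) ≠ 0 := by positivity
  simp only [empDist_eq_sum, div_eq_mul_inv]
  rw [expect_mul_const, expect_prodP_sum hp1 fun a => if φ a = b then (1 : ℝ) else 0,
    expect_comp hq fun b' => if b' = b then (1 : ℝ) else 0, expect_boole]
  field_simp

lemma expect_empDist_sq (hn : 0 < n) (hp1 : ∑ a, p a = 1)
    (hq : ∀ b, q b = ∑ a, if φ a = b then p a else 0) (b : β) :
    expect (prodP p) (fun s : Fin n → α => empDist (fun t => φ (s t)) b ^ 2) =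
      q b ^ 2 + q b * (1 - q b) / n := by
  have hn' : (n : ℝ) ≠ 0 := by positivity
  simp only [empDist_eq_sum, div_eq_mul_inv, mul_pow]
  rw [expect_mul_const, expect_prodP_sum_sq hp1 fun a => if φ a = b then (1 : ℝ) else 0]
  simp only [ite_pow, one_pow, zero_pow two_ne_zero]
  rw [expect_comp hq fun b' => if b' = b then (1 : ℝ) else 0, expect_boole]
  field_simp
  ring

/-- The bias of the plug-in entropy estimator is an expected relative entropy. -/
lemma ent_sub_expect_ent (hn : 0 < n) (hp1 : ∑ a, p a = 1)
    (hq : ∀ b, q b = ∑ a, if φ a = b then p a else 0) :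
    ent q - expect (prodP p) (fun s : Fin n → α => ent (empDist fun t => φ (s t))) =
      expect (prodP p) fun s : Fin n → α => relEnt (empDist fun t => φ (s t)) q := by
  have h : ∀ s : Fin n → α, relEnt (empDist fun t => φ (s t)) q =
      -ent (empDist fun t => φ (s t)) -
        ∑ b, empDist (fun t => φ (s t)) b * Real.logb 2 (q b) := fun s => by
    simp only [relEnt, ent, mul_sub, Finset.sum_sub_distrib, neg_neg]
  simp only [h, expect_sub, expect_sum, expect_mul_const, expect_empDist hn hp1 hq]
  rw [ent]
  have : expect (prodP p) (fun s : Fin n → α => -ent (empDist fun t => φ (s t))) =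
      -expect (prodP p) (fun s : Fin n → α => ent (empDist fun t => φ (s t))) := by
    simp [expect]
  rw [this]
  ring

lemma expect_ent_le (hn : 0 < n) (hp0 : ∀ a, 0 ≤ p a) (hp1 : ∑ a, p a = 1)
    (hq : ∀ b, q b = ∑ a, if φ a = b then p a else 0) (hq0 : ∀ b, 0 < q b) :
    expect (prodP p) (fun s : Fin n → α => ent (empDist fun t => φ (s t))) ≤ ent q := by
  rw [← sub_nonneg, ent_sub_expect_ent hn hp1 hq]
  exact Finset.sum_nonneg fun s _ => mul_nonneg (prodP_nonneg hp0 s)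
    (relEnt_nonneg (empDist_nonneg _) (sum_empDist hn _) hq0 (sum_pushforward hq hp1))

lemma ent_sub_expect_ent_le (hn : 0 < n) (hp0 : ∀ a, 0 ≤ p a) (hp1 : ∑ a, p a = 1)
    (hq : ∀ b, q b = ∑ a, if φ a = b then p a else 0) (hq0 : ∀ b, 0 < q b) :
    ent q - expect (prodP p) (fun s : Fin n → α => ent (empDist fun t => φ (s t))) ≤
      Real.logb 2 (1 + ((Fintype.card β : ℝ) - 1) / n) := by
  have hn' : (0 : ℝ) < n := by exact_mod_cast hn
  have hq1 := sum_pushforward hq hp1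
  have hcard : (1 : ℝ) ≤ Fintype.card β := by
    have : Nonempty β := by
      by_contra h
      rw [not_nonempty_iff] at h
      simp at hq1
    exact_mod_cast Fintype.card_pos
  set w : ℝ := 1 + ((Fintype.card β : ℝ) - 1) / n with hw
  have hw0 : 0 < w := by
    have : 0 ≤ ((Fintype.card β : ℝ) - 1) / n := div_nonneg (by linarith) hn'.le
    linarith
  have hchi : expect (prodP p)
      (fun s : Fin n → α => ∑ b, empDist (fun t => φ (s t)) b ^ 2 / q b) = w := by
    simp only [expect_sum, div_eq_mul_inv, expect_mul_const, expect_empDist_sq hn hp1 hq]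
    have h : ∀ b, (q b ^ 2 + q b * (1 - q b) * (n : ℝ)⁻¹) * (q b)⁻¹ =
        q b + (1 - q b) * (n : ℝ)⁻¹ := fun b => by
      have := (hq0 b).ne'
      field_simp
    rw [Finset.sum_congr rfl fun b _ => h b, Finset.sum_add_distrib, ← Finset.sum_mul,
      Finset.sum_sub_distrib, hq1]
    simp [hw, div_eq_mul_inv]
  rw [ent_sub_expect_ent hn hp1 hq]
  refine (expect_mono (prodP_nonneg hp0) fun s =>
    relEnt_le (empDist_nonneg _) (sum_empDist hn _) hq0 hw0).trans_eq ?_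
  simp only [div_eq_mul_inv, expect_add, expect_sub, expect_mul_const,
    expect_const (sum_prodP hp1)]
  simp only [div_eq_mul_inv] at hchi
  rw [hchi, mul_inv_cancel₀ hw0.ne']
  ring

end Bias

lemma eq_pushforward_id {α : Type*} [Fintype α] (p : α → ℝ) (b : α) :
    p b = ∑ a, if id a = b then p a else 0 := by
  simp

section Emi

variable {n : ℕ} {𝒳 𝒴 : Type*} [Fintype 𝒳] [Fintype 𝒴] {p : 𝒳 × 𝒴 → ℝ}

lemma sum_snd_eq_pushforward (p : 𝒳 × 𝒴 → ℝ) (x : 𝒳) :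
    ∑ y, p (x, y) = ∑ a : 𝒳 × 𝒴, if a.1 = x then p a else 0 := by
  rw [Fintype.sum_prod_type_right]
  simp

lemma sum_fst_eq_pushforward (p : 𝒳 × 𝒴 → ℝ) (y : 𝒴) :
    ∑ x, p (x, y) = ∑ a : 𝒳 × 𝒴, if a.2 = y then p a else 0 := by
  rw [Fintype.sum_prod_type]
  simp

lemma expect_emi (p : 𝒳 × 𝒴 → ℝ) :
    expect (prodP p) (fun s : Fin n → 𝒳 × 𝒴 => emi s) =
      expect (prodP p) (fun s : Fin n → 𝒳 × 𝒴 => ent (empDist fun t => (s t).1)) +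
        expect (prodP p) (fun s : Fin n → 𝒳 × 𝒴 => ent (empDist fun t => (s t).2)) -
        expect (prodP p) (fun s : Fin n → 𝒳 × 𝒴 => ent (empDist s)) := by
  simp only [emi, expect_sub, expect_add]

lemma marginal_fst_pos {𝒳 𝒴 : Type*} [Fintype 𝒴] {p : 𝒳 × 𝒴 → ℝ} [Nonempty 𝒴] (hp0 : ∀ a, 0 < p a) (x : 𝒳) : 0 < ∑ y, p (x, y) :=
  Finset.sum_pos (fun _ _ => hp0 _) Finset.univ_nonempty

lemma marginal_snd_pos {𝒳 𝒴 : Type*} [Fintype 𝒳] {p : 𝒳 × 𝒴 → ℝ} [Nonempty 𝒳] (hp0 : ∀ a, 0 < p a) (y : 𝒴) : 0 < ∑ x, p (x, y) :=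
  Finset.sum_pos (fun _ _ => hp0 _) Finset.univ_nonempty

lemma expect_emi_sub_le [Nonempty 𝒳] [Nonempty 𝒴] (hn : 0 < n) (hp0 : ∀ a, 0 < p a)
    (hp1 : ∑ a, p a = 1) :
    expect (prodP p) (fun s : Fin n → 𝒳 × 𝒴 => emi s) - miDist p ≤
      Real.logb 2 (1 + ((Fintype.card (𝒳 × 𝒴) : ℝ) - 1) / n) := by
  have hp := fun a => (hp0 a).le
  have h1 := expect_ent_le (n := n) (φ := Prod.fst) hn hp hp1 (sum_snd_eq_pushforward p)
    (marginal_fst_pos hp0)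
  have h2 := expect_ent_le (n := n) (φ := Prod.snd) hn hp hp1 (sum_fst_eq_pushforward p)
    (marginal_snd_pos hp0)
  have h3 := ent_sub_expect_ent_le (n := n) (φ := id) hn hp hp1 (eq_pushforward_id p) hp0
  simp only [id] at h3
  rw [expect_emi, miDist]
  linarith

lemma le_expect_emi_sub [Nonempty 𝒳] [Nonempty 𝒴] (hn : 0 < n) (hp0 : ∀ a, 0 < p a)
    (hp1 : ∑ a, p a = 1) :
    -(Real.logb 2 (1 + ((Fintype.card 𝒳 : ℝ) - 1) / n) +
        Real.logb 2 (1 + ((Fintype.card 𝒴 : ℝ) - 1) / n)) ≤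
      expect (prodP p) (fun s : Fin n → 𝒳 × 𝒴 => emi s) - miDist p := by
  have hp := fun a => (hp0 a).le
  have h1 := ent_sub_expect_ent_le (n := n) (φ := Prod.fst) hn hp hp1 (sum_snd_eq_pushforward p)
    (marginal_fst_pos hp0)
  have h2 := ent_sub_expect_ent_le (n := n) (φ := Prod.snd) hn hp hp1 (sum_fst_eq_pushforward p)
    (marginal_snd_pos hp0)
  have h3 := expect_ent_le (n := n) (φ := id) hn hp hp1 (eq_pushforward_id p) hp0
  simp only [id] at h3
  rw [expect_emi, miDist]
  linarith

end Emi

lemma logb_one_add_div_le {k m d : ℝ} (hk : 0 ≤ k) (hm : 0 < m) (hd : 0 < d)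
    (h : k / ((2 : ℝ) ^ d - 1) < m) : Real.logb 2 (1 + k / m) ≤ d := by
  have h1 : 0 < (2 : ℝ) ^ d - 1 := sub_pos.2 (Real.one_lt_rpow one_lt_two hd)
  have h2 : 0 ≤ k / m := div_nonneg hk hm.le
  rw [Real.logb_le_iff_le_rpow one_lt_two (by linarith)]
  rw [div_lt_iff₀ h1] at h
  have : k / m ≤ (2 : ℝ) ^ d - 1 := by
    rw [div_le_iff₀ hm]
    linarith
  linarith

/-- probability of mis-ordering two mutual informations. For independent
sample sets of size n from full-support pmfs P_{XY} and P_{X'Y'} on 𝒳 × 𝒳 with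
Δ = I(X' ∧ Y') − I(X ∧ Y) > 0 and n large enough,
P(I_EMI(X∧Y) ≥ I_EMI(X'∧Y')) is bounded by twice the larger of two exponential terms
involving the biases of the two estimators. -/
theorem emi_ordering_error {𝒳 : Type*} [Fintype 𝒳] {n : ℕ}
    (p p' : 𝒳 × 𝒳 → ℝ)
    (hp0 : ∀ ab, 0 < p ab) (hp1 : ∑ ab, p ab = 1)
    (hp0' : ∀ ab, 0 < p' ab) (hp1' : ∑ ab, p' ab = 1)
    (Δ : ℝ) (hΔdef : Δ = miDist p' - miDist p) (hΔpos : 0 < Δ)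
    (hn : (n : ℝ) > max (((Fintype.card 𝒳 : ℝ) ^ 2 - 1) / ((2 : ℝ) ^ (Δ / 2) - 1))
                        (((Fintype.card 𝒳 : ℝ) - 1) / ((2 : ℝ) ^ (Δ / 4) - 1))) :
    probEvent (fun ω : (Fin n → 𝒳 × 𝒳) × (Fin n → 𝒳 × 𝒳) => prodP p ω.1 * prodP p' ω.2)
        (fun ω => emi ω.1 ≥ emi ω.2)
      ≤ 2 * max
          (Real.exp (-(2 * n * (Δ / 2 - (expect (prodP p) (fun ω : Fin n → 𝒳 × 𝒳 => emi ω) - miDist p)) ^ 2)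
            / (36 * Real.logb 2 n ^ 2)))
          (Real.exp (-(2 * n * (Δ / 2 - (expect (prodP p') (fun ω : Fin n → 𝒳 × 𝒳 => emi ω) - miDist p')) ^ 2)
            / (36 * Real.logb 2 n ^ 2))) := by
  have hne : Nonempty 𝒳 := by
    by_contra h
    rw [not_nonempty_iff] at h
    simp at hp1
  have hk : (1 : ℝ) ≤ Fintype.card 𝒳 := by exact_mod_cast Fintype.card_pos
  have hk2 : 0 ≤ (Fintype.card 𝒳 : ℝ) ^ 2 - 1 := by nlinarith
  obtain ⟨hn2, hn1⟩ := max_lt_iff.1 hn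
  have hn0' : (0 : ℝ) < n := lt_of_le_of_lt (div_nonneg hk2
    (sub_nonneg.2 (Real.one_le_rpow one_le_two (by positivity)))) hn2
  have hn0 : 0 < n := by exact_mod_cast hn0'
  have hb := expect_emi_sub_le (n := n) hn0 hp0 hp1
  have hb' := le_expect_emi_sub (n := n) hn0 hp0' hp1'
  have hl2 := logb_one_add_div_le hk2 hn0' (by positivity) hn2
  have hl1 := logb_one_add_div_le (sub_nonneg.2 hk) hn0' (by positivity) hn1
  rw [Fintype.card_prod, Nat.cast_mul, ← sq] at hb
  set E := expect (prodP p) (fun ω : Fin n → 𝒳 × 𝒳 => emi ω)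
  set E' := expect (prodP p') (fun ω : Fin n → 𝒳 × 𝒳 => emi ω)
  have hx : 0 ≤ Δ / 2 - (E - miDist p) := by linarith
  have hT : Δ / 2 - (E - miDist p) ≤ E' - E := by linarith
  rcases Nat.lt_or_ge n 2 with hlt | hge
  · obtain rfl : n = 1 := by omega
    have hP : probEvent
        (fun ω : (Fin 1 → 𝒳 × 𝒳) × (Fin 1 → 𝒳 × 𝒳) => prodP p ω.1 * prodP p' ω.2)
        (fun ω => emi ω.1 ≥ emi ω.2) ≤ 1 := by
      calc _ ≤ ∑ ω : (Fin 1 → 𝒳 × 𝒳) × (Fin 1 → 𝒳 × 𝒳), prodP p ω.1 * prodP p' ω.2 :=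
            Finset.sum_le_sum fun ω _ => by
              split_ifs
              · exact le_rfl
              · exact mul_nonneg (prodP_nonneg (fun a => (hp0 a).le) _)
                  (prodP_nonneg (fun a => (hp0' a).le) _)
        _ = (∑ ω : Fin 1 → 𝒳 × 𝒳, prodP p ω) * ∑ ω : Fin 1 → 𝒳 × 𝒳, prodP p' ω := by
          rw [Finset.sum_mul_sum, ← Fintype.sum_prod_type']
        _ = 1 := by rw [sum_prodP hp1, sum_prodP hp1', one_mul]
    refine hP.trans ?_
    simp
  · have hlog : 0 < Real.logb 2 n := Real.logb_pos one_lt_two (by exact_mod_cast hge)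
    refine (probEvent_ge_le (fun a => (hp0 a).le) hp1 (fun a => (hp0' a).le) hp1'
      (fun ω => emi ω) (abs_emi_update_sub_le hge) hn0 (by positivity) (by linarith)).trans ?_
    refine le_trans (le_trans (Real.exp_le_exp.2 ?_) (le_max_left _ _))
      (le_mul_of_one_le_left (le_max_of_le_left (Real.exp_pos _).le) one_le_two)
    have hsq : (Δ / 2 - (E - miDist p)) ^ 2 ≤ (E' - E) ^ 2 := pow_le_pow_left₀ hx hT 2
    calc -(E' - E) ^ 2 / (n * (4 * Real.logb 2 n / n) ^ 2)
        = -(n * (E' - E) ^ 2 / (16 * Real.logb 2 n ^ 2)) := by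
          field_simp
          ring
      _ ≤ -(n * (Δ / 2 - (E - miDist p)) ^ 2 / (18 * Real.logb 2 n ^ 2)) := by
          refine neg_le_neg ?_
          gcongr
          norm_num
      _ = _ := by
          field_simp
          ring

end EMI
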